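/- arXiv:1812.05413 — 15 statements merged into one kernel-verified Lean document; each statement's English description precedes it below -/
import Mathlib

section
/- Fix i ∈ {1,2}. The function w ↦ R_i^{PN}(p̃_0^{PN}(w), w) is a quadratic polynomial in w that is strictly concave, and its unique global maximizer over ℝ is w̃_i = c_i/2 + (1/(1−γ))·(h_i Q_i/(2 p_i S) + Q/(2S) + (r_0 − c̃_0)/2). -/
theorem strictConcaveOn_sub_mul_sq {k : ℝ} (hk : 0 < k) (m v : ℝ) :
    StrictConcaveOn ℝ Set.univ (fun w : ℝ => m - k * (w - v) ^ 2) := by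
  refine ⟨convex_univ, fun x _ y _ hxy a b ha hb hab => ?_⟩
  obtain rfl : b = 1 - a := by linarith
  simp only [smul_eq_mul]
  have hpos : 0 < k * (a * (1 - a) * (x - y) ^ 2) :=
    mul_pos hk (mul_pos (mul_pos ha hb) (sq_pos_iff.mpr (sub_ne_zero.mpr hxy)))
  linear_combination hpos

/-- Part-NonPart scenario, wholesale price optimization.
Fix `i ∈ {1,2}` (indices `0, 1` of `Fin 2` stand for MNO 1 and MNO 2).
The function `w ↦ R_i^{PN}(p̃_0^{PN}(w), w)` is a quadratic polynomial in `w` that is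
strictly concave, and its unique global maximizer over `ℝ` is
`w̃_i = c_i/2 + (1/(1−γ))·(h_i Q_i/(2 p_i S) + Q/(2S) + (r_0 − c̃_0)/2)`. -/
theorem stmt_1
    (Q p c ct Cbar : Fin 2 → ℝ) (r0 ct0 ε γ : ℝ) (i : Fin 2)
    (hQ : ∀ k, 0 < Q k) (hp2 : 0 < p 1) (hp12 : p 1 ≤ p 0)
    (hc : ∀ k, 0 ≤ c k) (hct : ∀ k, 0 ≤ ct k) (hct0 : 0 ≤ ct0)
    (hε : 0 < ε) (hγ0 : 0 ≤ γ) (hγ1 : γ < 1)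
    (Qt S : ℝ) (hQt : Qt = Q 0 + Q 1) (hS : S = Q 0 / p 0 + Q 1 / p 1)
    (h : Fin 2 → ℝ) (hh : ∀ k, h k = p k - c k - ct k)
    (Qdef : Fin 2 → ℝ → ℝ) (hQdef : ∀ k p0, Qdef k p0 = ε * Q k * (p k - p0) / p k)
    (Q0 : ℝ → ℝ) (hQ0 : ∀ p0, Q0 p0 = ε * (Qt - S * p0))
    (Ri : ℝ → ℝ → ℝ)
    (hRi : ∀ p0 w,
      Ri p0 w = h i * (Q i - Qdef i p0) + (w - c i) * (1 - γ) * Q0 p0 - Cbar i)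
    (pt : ℝ → ℝ) (hpt : ∀ w, pt w = (1 - γ) * w / 2 + Qt / (2 * S) + (ct0 - r0) / 2)
    (wt : ℝ)
    (hwt : wt = c i / 2 +
      (1 / (1 - γ)) * (h i * Q i / (2 * p i * S) + Qt / (2 * S) + (r0 - ct0) / 2)) :
    (∃ a b cc : ℝ, a < 0 ∧ ∀ w, Ri (pt w) w = a * w ^ 2 + b * w + cc) ∧
    StrictConcaveOn ℝ Set.univ (fun w => Ri (pt w) w) ∧
    (∀ w, w ≠ wt → Ri (pt w) w < Ri (pt wt) wt) := by
  have hp : ∀ k, 0 < p k := by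
    intro k
    fin_cases k
    · exact hp2.trans_le hp12
    · exact hp2
  have hSpos : 0 < S := by
    rw [hS]
    exact add_pos (div_pos (hQ 0) (hp 0)) (div_pos (hQ 1) (hp 1))
  have hγ : 0 < 1 - γ := sub_pos.mpr hγ1
  have hk : 0 < ε * S * (1 - γ) ^ 2 / 2 := by positivity
  have vertex_form : ∀ w,
      Ri (pt w) w = Ri (pt wt) wt - ε * S * (1 - γ) ^ 2 / 2 * (w - wt) ^ 2 := by
    intro w
    have hpi := (hp i).ne'
    have hS0 := hSpos.ne'
    have hγne := hγ.ne'
    have hfoc : h i * Q i / p i =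
        S * (1 - γ) * (2 * wt - c i) - Qt - S * (r0 - ct0) := by
      rw [hwt]
      field_simp
      ring
    have hdef : ∀ p0, h i * (Q i - Qdef i p0) =
        h i * Q i - ε * (h i * Q i) + ε * (h i * Q i / p i) * p0 := by
      intro p0
      rw [hQdef]
      field_simp
      ring
    have hmul : ∀ x, S * pt x = S * (1 - γ) * x / 2 + Qt / 2 + S * (ct0 - r0) / 2 := by
      intro x
      rw [hpt]
      field_simp
    have hdiff : pt w - pt wt = (1 - γ) * (w - wt) / 2 := by
      rw [hpt, hpt]
      ring
    rw [hRi, hRi, hQ0, hQ0, hdef, hdef, hmul, hmul, hfoc]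
    linear_combination
      ε * (S * (1 - γ) * (2 * wt - c i) - Qt - S * (r0 - ct0)) * hdiff
  refine ⟨⟨-(ε * S * (1 - γ) ^ 2 / 2), ε * S * (1 - γ) ^ 2 * wt,
    Ri (pt wt) wt - ε * S * (1 - γ) ^ 2 / 2 * wt ^ 2, neg_lt_zero.mpr hk, fun w => ?_⟩, ?_, ?_⟩
  · rw [vertex_form w]
    ring
  · rw [funext vertex_form]
    exact strictConcaveOn_sub_mul_sq hk _ _
  · intro w hw
    rw [vertex_form w]
    exact sub_lt_self _ (mul_pos hk (sq_pos_iff.mpr (sub_ne_zero.mpr hw)))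
end

section
/- Fix i ∈ {1,2} and assume w̃_i ≥ 0 and w̄_i ≥ 0. Then ŵ_i = min(w̄_i, w̃_i) is the unique maximizer of the function w ↦ R_i^{PN}(p̃_0^{PN}(w), w) over the interval [0, w̄_i]. -/
/-- Among points below `b`, the point `min b t` is strictly closest to `t`. -/
theorem sq_min_sub_lt_sq_sub {b t w : ℝ} (hw : w ≤ b) (hne : w ≠ min b t) :
    (min b t - t) ^ 2 < (w - t) ^ 2 := by
  rcases le_total b t with hbt | hbt
  · rw [min_eq_left hbt] at hne ⊢
    have hlt : w < b := lt_of_le_of_ne hw hne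
    nlinarith
  · rw [min_eq_right hbt] at hne ⊢
    have hpos : 0 < (w - t) ^ 2 := sq_pos_of_ne_zero (sub_ne_zero.mpr hne)
    simpa using hpos


/-- Proposition 1, Part-NonPart scenario.
Fix `i ∈ {1,2}` and assume `w̃_i ≥ 0` and `w̄_i ≥ 0`. Then `ŵ_i = min(w̄_i, w̃_i)` is the
unique maximizer of `w ↦ R_i^{PN}(p̃_0^{PN}(w), w)` over the interval `[0, w̄_i]`. -/
theorem stmt_3
    (Q p c ct Cbar : Fin 2 → ℝ) (r0 ct0 ε γ : ℝ) (i : Fin 2)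
    (hQ : ∀ k, 0 < Q k) (hp2 : 0 < p 1) (hp12 : p 1 ≤ p 0)
    (hc : ∀ k, 0 ≤ c k) (hct : ∀ k, 0 ≤ ct k) (hct0 : 0 ≤ ct0)
    (hε : 0 < ε) (hγ0 : 0 ≤ γ) (hγ1 : γ < 1)
    (Qt S : ℝ) (hQt : Qt = Q 0 + Q 1) (hS : S = Q 0 / p 0 + Q 1 / p 1)
    (h : Fin 2 → ℝ) (hh : ∀ k, h k = p k - c k - ct k)
    (Qdef : Fin 2 → ℝ → ℝ) (hQdef : ∀ k p0, Qdef k p0 = ε * Q k * (p k - p0) / p k)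
    (Q0 : ℝ → ℝ) (hQ0 : ∀ p0, Q0 p0 = ε * (Qt - S * p0))
    (Ri : ℝ → ℝ → ℝ)
    (hRi : ∀ p0 w,
      Ri p0 w = h i * (Q i - Qdef i p0) + (w - c i) * (1 - γ) * Q0 p0 - Cbar i)
    (pt : ℝ → ℝ) (hpt : ∀ w, pt w = (1 - γ) * w / 2 + Qt / (2 * S) + (ct0 - r0) / 2)
    (wt : ℝ)
    (hwt : wt = c i / 2 +
      (1 / (1 - γ)) * (h i * Q i / (2 * p i * S) + Qt / (2 * S) + (r0 - ct0) / 2))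
    (wbar : ℝ) (hwbar : wbar = (1 / (1 - γ)) * (2 * p 1 - Qt / S + r0 - ct0))
    (hwt0 : 0 ≤ wt) (hwbar0 : 0 ≤ wbar) :
    min wbar wt ∈ Set.Icc (0 : ℝ) wbar ∧
    IsMaxOn (fun w => Ri (pt w) w) (Set.Icc 0 wbar) (min wbar wt) ∧
    (∀ w ∈ Set.Icc (0 : ℝ) wbar, w ≠ min wbar wt →
      Ri (pt w) w < Ri (pt (min wbar wt)) (min wbar wt)) := by
  have hp : ∀ k, 0 < p k := by
    intro k
    fin_cases k
    · exact hp2.trans_le hp12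
    · exact hp2
  have hSpos : 0 < S := by
    rw [hS]
    exact add_pos (div_pos (hQ 0) (hp 0)) (div_pos (hQ 1) (hp 1))
  have hγ : 0 < 1 - γ := sub_pos.mpr hγ1
  have hprofit : ∀ w, Ri (pt w) w =
      Ri (pt wt) wt - (1 - γ) ^ 2 * ε * S / 2 * (w - wt) ^ 2 := by
    intro w
    have hpi := (hp i).ne'
    have hSne := hSpos.ne'
    have hγne := hγ.ne'
    simp only [hRi, hQdef, hQ0, hpt]
    rw [hwt]
    generalize h i = m
    clear * - hpi hSne hγne
    field_simp
    ring
  have hcoef : 0 < (1 - γ) ^ 2 * ε * S / 2 := by positivity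
  have hstrict : ∀ w ∈ Set.Icc (0 : ℝ) wbar, w ≠ min wbar wt →
      Ri (pt w) w < Ri (pt (min wbar wt)) (min wbar wt) := by
    intro w hw hne
    rw [hprofit w, hprofit (min wbar wt)]
    exact sub_lt_sub_left
      (mul_lt_mul_of_pos_left (sq_min_sub_lt_sq_sub hw.2 hne) hcoef) _
  refine ⟨⟨le_min hwbar0 hwt0, min_le_left _ _⟩, ?_, hstrict⟩
  intro w hw
  by_cases hne : w = min wbar wt
  · simp [hne]
  · exact (hstrict w hw hne).le
end

section
/- Fix i ∈ {1,2} and set ŵ_i = min(w̄_i, w̃_i). Then the following three conditions are equivalent: (a) w̄_i ≤ w̃_i; (b) min(p̃_0^{PN}(ŵ_i), p_2) = p_2; (c) r_0 ≤ r̄_{i,0}, where r̄_{i,0} = h_i Q_i/(p_i S) + c_i(1−γ) + 3Q/S + c̃_0 − 4p_2. -/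
/-- Proposition 1, equivalence of boundary conditions.
Fix `i ∈ {1,2}` and set `ŵ_i = min(w̄_i, w̃_i)`. The following are equivalent:
(a) `w̄_i ≤ w̃_i`; (b) `min(p̃_0^{PN}(ŵ_i), p_2) = p_2`; (c) `r_0 ≤ r̄_{i,0}`,
where `r̄_{i,0} = h_i Q_i/(p_i S) + c_i(1−γ) + 3Q/S + c̃_0 − 4p_2`. -/
theorem stmt_4
    (Q p c ct : Fin 2 → ℝ) (r0 ct0 γ : ℝ) (i : Fin 2)
    (hQ : ∀ k, 0 < Q k) (hp2 : 0 < p 1) (hp12 : p 1 ≤ p 0)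
    (hc : ∀ k, 0 ≤ c k) (hct : ∀ k, 0 ≤ ct k) (hct0 : 0 ≤ ct0)
    (hγ0 : 0 ≤ γ) (hγ1 : γ < 1)
    (Qt S : ℝ) (hQt : Qt = Q 0 + Q 1) (hS : S = Q 0 / p 0 + Q 1 / p 1)
    (h : Fin 2 → ℝ) (hh : ∀ k, h k = p k - c k - ct k)
    (pt : ℝ → ℝ) (hpt : ∀ w, pt w = (1 - γ) * w / 2 + Qt / (2 * S) + (ct0 - r0) / 2)
    (wt : ℝ)
    (hwt : wt = c i / 2 +
      (1 / (1 - γ)) * (h i * Q i / (2 * p i * S) + Qt / (2 * S) + (r0 - ct0) / 2))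
    (wbar : ℝ) (hwbar : wbar = (1 / (1 - γ)) * (2 * p 1 - Qt / S + r0 - ct0))
    (what : ℝ) (hwhat : what = min wbar wt)
    (rbar : ℝ)
    (hrbar : rbar = h i * Q i / (p i * S) + c i * (1 - γ) + 3 * Qt / S + ct0 - 4 * p 1) :
    (wbar ≤ wt ↔ r0 ≤ rbar) ∧
    (min (pt what) (p 1) = p 1 ↔ r0 ≤ rbar) ∧
    (wbar ≤ wt ↔ min (pt what) (p 1) = p 1) := by
  have hγ : 0 < 1 - γ := sub_pos.2 hγ1
  have hB : Qt / (2 * S) = Qt / S / 2 := by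
    rw [div_div]; congr 1; ring
  have hdiff : (1 - γ) * (wt - wbar) = (rbar - r0) / 2 := by
    have hA : h i * Q i / (2 * p i * S) = h i * Q i / (p i * S) / 2 := by
      rw [div_div]; congr 1; ring
    have hC : 3 * Qt / S = 3 * (Qt / S) := mul_div_assoc _ _ _
    rw [hwt, hwbar, hrbar, hA, hB, hC]
    field_simp [hγ.ne']
    ring
  have hpt_sub : ∀ w, pt w - p 1 = (1 - γ) * (w - wbar) / 2 := by
    intro w
    have hw : (1 - γ) * wbar = 2 * p 1 - Qt / S + r0 - ct0 := by
      rw [hwbar, ← mul_assoc, mul_one_div_cancel hγ.ne', one_mul]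
    rw [hpt, hB]
    linarith
  have hac : wbar ≤ wt ↔ r0 ≤ rbar := by
    rw [← sub_nonneg, ← mul_nonneg_iff_of_pos_left hγ, hdiff]
    constructor <;> intro _ <;> linarith
  have hab : wbar ≤ wt ↔ min (pt what) (p 1) = p 1 := by
    have hle : wbar ≤ what ↔ wbar ≤ wt := by simp [hwhat]
    rw [min_eq_right_iff, ← hle, ← sub_nonneg, ← mul_nonneg_iff_of_pos_left hγ,
      ← sub_nonneg (a := pt what), hpt_sub]
    constructor <;> intro _ <;> linarith
  exact ⟨hac, hab.symm.trans hac, hab⟩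
end

section
/- Fix i ∈ {1,2} and fix w_i ∈ ℝ. The function w ↦ R_{−i}^*(w_1,w_2), where w_{−i} = w and the other coordinate equals w_i, is a strictly concave quadratic polynomial in w, and its unique global maximizer over ℝ is Ω_{−i}(w_i) = c_{−i}/2 + h_{−i}Q_{−i}/(2 p_{−i}(1−γ)π_{−i}S) + Q/(2(1−γ)π_{−i}S) − (c̃_0 − r_0)/(2(1−γ)π_{−i}) − (π_i/(2π_{−i})) w_i. -/
theorem strictConcaveOn_of_eq_sub_mul_sq {F : ℝ → ℝ} {K m M : ℝ} (hK : 0 < K)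
    (hF : ∀ x, F x = M - K * (x - m) ^ 2) : StrictConcaveOn ℝ Set.univ F := by
  refine ⟨convex_univ, fun x _ y _ hxy a b ha hb hab => ?_⟩
  obtain rfl : b = 1 - a := by linarith
  have hpos : 0 < K * (a * (1 - a)) * (x - y) ^ 2 :=
    mul_pos (mul_pos hK (mul_pos ha hb)) (sq_pos_of_ne_zero (sub_ne_zero.mpr hxy))
  simp only [hF, smul_eq_mul]
  linear_combination hpos

/-- Part-Part scenario, follower best response.
Fix `i ∈ {1,2}`, let `−i` (here `j`) denote the other MNO, and fix `w_i ∈ ℝ`.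
The function `w ↦ R_{−i}^*(w_1,w_2)`, where `w_{−i} = w` and the other coordinate
equals `w_i`, is a strictly concave quadratic polynomial in `w`, and its unique global
maximizer over `ℝ` is `Ω_{−i}(w_i)`. -/
theorem stmt_6
    (Q p c ct Cbar : Fin 2 → ℝ) (r0 ct0 ε γ : ℝ) (i j : Fin 2) (hij : j ≠ i)
    (hQ : ∀ k, 0 < Q k) (hp2 : 0 < p 1) (hp12 : p 1 ≤ p 0)
    (hc : ∀ k, 0 ≤ c k) (hct : ∀ k, 0 ≤ ct k) (hct0 : 0 ≤ ct0)
    (hε : 0 < ε) (hγ0 : 0 ≤ γ) (hγ1 : γ < 1)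
    (Qt S : ℝ) (hQt : Qt = Q 0 + Q 1) (hS : S = Q 0 / p 0 + Q 1 / p 1)
    (sh h : Fin 2 → ℝ) (hsh : ∀ k, sh k = Q k / Qt) (hh : ∀ k, h k = p k - c k - ct k)
    (Qdef : Fin 2 → ℝ → ℝ) (hQdef : ∀ k p0, Qdef k p0 = ε * Q k * (p k - p0) / p k)
    (Q0 : ℝ → ℝ) (hQ0 : ∀ p0, Q0 p0 = ε * (Qt - S * p0))
    (pt : ℝ → ℝ → ℝ)
    (hptdef : ∀ wi wj,
      pt wi wj = (1 - γ) * (sh i * wi + sh j * wj) / 2 + Qt / (2 * S) + (ct0 - r0) / 2)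
    (wi : ℝ)
    (F : ℝ → ℝ)
    (hF : ∀ x, F x = h j * (Q j - Qdef j (pt wi x)) +
      (x - c j) * (1 - γ) * sh j * Q0 (pt wi x) - Cbar j)
    (Ω : ℝ)
    (hΩ : Ω = c j / 2 + h j * Q j / (2 * p j * (1 - γ) * sh j * S)
      + Qt / (2 * (1 - γ) * sh j * S)
      - (ct0 - r0) / (2 * (1 - γ) * sh j) - (sh i / (2 * sh j)) * wi) :
    (∃ a b cc : ℝ, a < 0 ∧ ∀ x, F x = a * x ^ 2 + b * x + cc) ∧
    StrictConcaveOn ℝ Set.univ F ∧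
    (∀ x, x ≠ Ω → F x < F Ω) := by
  have hp : ∀ k, 0 < p k := Fin.forall_fin_two.mpr ⟨hp2.trans_le hp12, hp2⟩
  have hSpos : 0 < S := by
    rw [hS]
    exact add_pos (div_pos (hQ 0) (hp 0)) (div_pos (hQ 1) (hp 1))
  have hshpos : 0 < sh j := by
    rw [hsh, hQt]
    exact div_pos (hQ j) (add_pos (hQ 0) (hQ 1))
  have hg : 0 < 1 - γ := sub_pos.mpr hγ1
  obtain ⟨K, hKdef⟩ : ∃ K, K = ε * S * (1 - γ) ^ 2 * sh j ^ 2 / 2 := ⟨_, rfl⟩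
  have hK : 0 < K := by
    rw [hKdef]
    positivity
  have key : ∀ x, F x = F Ω - K * (x - Ω) ^ 2 := by
    intro x
    have hpj := (hp j).ne'
    have hSne := hSpos.ne'
    have hshne := hshpos.ne'
    have hgne := hg.ne'
    rw [hF, hF, hQdef, hQdef, hQ0, hQ0, hptdef, hptdef, hΩ, hKdef]
    generalize 1 - γ = g at *
    field_simp
    ring
  refine ⟨⟨-K, 2 * K * Ω, F Ω - K * Ω ^ 2, neg_lt_zero.mpr hK, fun x => ?_⟩,
    strictConcaveOn_of_eq_sub_mul_sq hK key, fun x hx => ?_⟩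
  · rw [key x]
    ring
  · rw [key x]
    exact sub_lt_self _ (mul_pos hK (sq_pos_of_ne_zero (sub_ne_zero.mpr hx)))
end

section
/- Fix i ∈ {1,2}. In the fully sequential model with leader MNO i, the leader profit R_i^{**}(w_i) = R_i^*(w_1,w_2) evaluated at w_{−i} = Ω_{−i}(w_i) is a quadratic polynomial in w_i whose second derivative is the negative constant −ε(1−γ)²π_i²S/2, and its unique global maximizer over ℝ is w̃_i^{FS} = (h_i Q_i/p_i − h_{−i}Q_{−i}/p_{−i} + S(1−γ)(c_iπ_i − c_{−i}π_{−i}) + T)/(2(1−γ)π_i S), where T = Q + (r_0 − c̃_0)S. -/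
theorem deriv_deriv_const_mul_sub_sq_add (a v m w : ℝ) :
    deriv (deriv fun x : ℝ => a * (x - v) ^ 2 + m) w = 2 * a := by
  have h₁ : (deriv fun x : ℝ => a * (x - v) ^ 2 + m) = fun x => 2 * a * (x - v) := by
    funext x
    have hx := ((((hasDerivAt_id x).sub_const v).pow 2).const_mul a).add_const m
    refine HasDerivAt.deriv (hx.congr_deriv ?_)
    simp only [id]
    push_cast
    ring
  rw [h₁]
  refine HasDerivAt.deriv ((((hasDerivAt_id w).sub_const v).const_mul (2 * a)).congr_deriv ?_)
  ring

/-- Fully sequential model, leader profit.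
Fix `i ∈ {1,2}` (the leader), and let `−i` (here `j`) be the follower. The leader
profit `R_i^{**}(w_i) = R_i^*(w_1,w_2)` evaluated at `w_{−i} = Ω_{−i}(w_i)` is a
quadratic polynomial in `w_i` whose second derivative is the negative constant
`−ε(1−γ)²π_i²S/2`, and its unique global maximizer over `ℝ` is `w̃_i^{FS}`. -/
theorem stmt_7
    (Q p c ct Cbar : Fin 2 → ℝ) (r0 ct0 ε γ : ℝ) (i j : Fin 2) (hij : j ≠ i)
    (hQ : ∀ k, 0 < Q k) (hp2 : 0 < p 1) (hp12 : p 1 ≤ p 0)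
    (hc : ∀ k, 0 ≤ c k) (hct : ∀ k, 0 ≤ ct k) (hct0 : 0 ≤ ct0)
    (hε : 0 < ε) (hγ0 : 0 ≤ γ) (hγ1 : γ < 1)
    (Qt S T : ℝ) (hQt : Qt = Q 0 + Q 1) (hS : S = Q 0 / p 0 + Q 1 / p 1)
    (hT : T = Qt + (r0 - ct0) * S)
    (sh h : Fin 2 → ℝ) (hsh : ∀ k, sh k = Q k / Qt) (hh : ∀ k, h k = p k - c k - ct k)
    (Qdef : Fin 2 → ℝ → ℝ) (hQdef : ∀ k p0, Qdef k p0 = ε * Q k * (p k - p0) / p k)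
    (Q0 : ℝ → ℝ) (hQ0 : ∀ p0, Q0 p0 = ε * (Qt - S * p0))
    (pt : ℝ → ℝ → ℝ)
    (hptdef : ∀ wi wj,
      pt wi wj = (1 - γ) * (sh i * wi + sh j * wj) / 2 + Qt / (2 * S) + (ct0 - r0) / 2)
    (Ω : ℝ → ℝ)
    (hΩ : ∀ wi, Ω wi = c j / 2 + h j * Q j / (2 * p j * (1 - γ) * sh j * S)
      + Qt / (2 * (1 - γ) * sh j * S)
      - (ct0 - r0) / (2 * (1 - γ) * sh j) - (sh i / (2 * sh j)) * wi)
    (F : ℝ → ℝ)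
    (hF : ∀ w, F w = h i * (Q i - Qdef i (pt w (Ω w))) +
      (w - c i) * (1 - γ) * sh i * Q0 (pt w (Ω w)) - Cbar i)
    (wtFS : ℝ)
    (hwtFS : wtFS = (h i * Q i / p i - h j * Q j / p j
      + S * (1 - γ) * (c i * sh i - c j * sh j) + T) / (2 * (1 - γ) * sh i * S)) :
    (∃ a b cc : ℝ, ∀ w, F w = a * w ^ 2 + b * w + cc) ∧
    (∀ w, deriv (deriv F) w = -(ε * (1 - γ) ^ 2 * sh i ^ 2 * S / 2)) ∧
    (∀ w, w ≠ wtFS → F w < F wtFS) := by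
  have hp : ∀ k, 0 < p k := by
    intro k
    fin_cases k
    · exact hp2.trans_le hp12
    · exact hp2
  have hQt_pos : 0 < Qt := hQt ▸ add_pos (hQ 0) (hQ 1)
  have hS_pos : 0 < S := hS ▸ add_pos (div_pos (hQ 0) (hp 0)) (div_pos (hQ 1) (hp 1))
  have hsh_pos : ∀ k, 0 < sh k := fun k => hsh k ▸ div_pos (hQ k) hQt_pos
  have hγ_pos : 0 < 1 - γ := sub_pos.mpr hγ1
  have hS_ne := hS_pos.ne'
  have hγ_ne := hγ_pos.ne'
  have hshi_ne := (hsh_pos i).ne'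
  have hshj_ne := (hsh_pos j).ne'
  have hpi_ne := (hp i).ne'
  have hpj_ne := (hp j).ne'
  have price : ∀ w, pt w (Ω w) = (1 - γ) * sh i * w / 4 + ((1 - γ) * sh j * c j / 4
      + h j * Q j / p j / (4 * S) + 3 * Qt / (4 * S) + (ct0 - r0) / 4) := by
    intro w
    rw [hptdef, hΩ]
    field_simp
    ring
  have price_wtFS : 4 * S * pt wtFS (Ω wtFS) = (1 - γ) * sh i * S * wtFS
      + (1 - γ) * sh j * c j * S + h j * Q j / p j + 3 * Qt + S * (ct0 - r0) := by
    rw [price]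
    field_simp
    ring
  have price_sub : ∀ w, pt w (Ω w) = pt wtFS (Ω wtFS) + (1 - γ) * sh i * (w - wtFS) / 4 := by
    intro w
    rw [price w, price wtFS]
    ring
  have first_order : 2 * (1 - γ) * sh i * S * wtFS = h i * Q i / p i - h j * Q j / p j
      + S * (1 - γ) * (c i * sh i - c j * sh j) + T := by
    rw [hwtFS]
    exact mul_div_cancel₀ _ (by positivity)
  have retained : ∀ x, h i * (Q i - Qdef i x)
      = h i * Q i - ε * (h i * Q i) + ε * (h i * Q i / p i) * x := by
    intro x
    rw [hQdef]
    field_simp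
    ring
  have hF_sq : ∀ w, F w = -(ε * (1 - γ) ^ 2 * sh i ^ 2 * S / 4) * (w - wtFS) ^ 2 + F wtFS := by
    intro w
    rw [hF w, hF wtFS, retained, retained, hQ0, hQ0, price_sub w]
    generalize pt wtFS (Ω wtFS) = x at *
    generalize h i * Q i / p i = A at *
    generalize h j * Q j / p j = B at *
    subst hT
    linear_combination (-(ε * (1 - γ) * sh i * (w - wtFS) / 4)) * (price_wtFS + first_order)
  refine ⟨⟨-(ε * (1 - γ) ^ 2 * sh i ^ 2 * S / 4), ε * (1 - γ) ^ 2 * sh i ^ 2 * S / 2 * wtFS,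
    -(ε * (1 - γ) ^ 2 * sh i ^ 2 * S / 4) * wtFS ^ 2 + F wtFS, fun w => ?_⟩, fun w => ?_,
    fun w hw => ?_⟩
  · rw [hF_sq w]
    ring
  · rw [funext hF_sq, deriv_deriv_const_mul_sub_sq_add]
    ring
  · have hsq : 0 < (w - wtFS) ^ 2 := sq_pos_of_ne_zero (sub_ne_zero.mpr hw)
    have hcoef : 0 < ε * (1 - γ) ^ 2 * sh i ^ 2 * S / 4 := by
      have := hsh_pos i
      positivity
    rw [hF_sq w]
    linarith [mul_pos hcoef hsq]
end

section
/- Fix i ∈ {1,2}. For every w_i ∈ ℝ, one has p̃_0^{PP}(w_1,w_2) ≤ p_2 at the point with coordinates w_i and w_{−i} = Ω_{−i}(w_i) if and only if w_i ≤ w̄_i^{FS}, where w̄_i^{FS} = (−h_{−i}Q_{−i}/p_{−i} − c_{−i}(1−γ)π_{−i}S − 4Q + 4p_2 S + T)/((1−γ)π_i S) and T = Q + (r_0 − c̃_0)S; moreover the map w_i ↦ p̃_0^{PP} evaluated at (w_i, Ω_{−i}(w_i)) is strictly increasing, affine with slope (1−γ)π_i/4. -/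
/-- Fully sequential model, boundary condition along the best response.
Fix `i ∈ {1,2}` (the leader) and let `−i` (here `j`) be the follower. For every
`w_i ∈ ℝ`, `p̃_0^{PP} ≤ p_2` at the point with coordinates `w_i` and `w_{−i} = Ω_{−i}(w_i)`
iff `w_i ≤ w̄_i^{FS}`; moreover `w_i ↦ p̃_0^{PP}(w_i, Ω_{−i}(w_i))` is strictly increasing
and affine with slope `(1−γ)π_i/4`. -/
theorem stmt_8
    (Q p c ct : Fin 2 → ℝ) (r0 ct0 γ : ℝ) (i j : Fin 2) (hij : j ≠ i)
    (hQ : ∀ k, 0 < Q k) (hp2 : 0 < p 1) (hp12 : p 1 ≤ p 0)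
    (hc : ∀ k, 0 ≤ c k) (hct : ∀ k, 0 ≤ ct k) (hct0 : 0 ≤ ct0)
    (hγ0 : 0 ≤ γ) (hγ1 : γ < 1)
    (Qt S T : ℝ) (hQt : Qt = Q 0 + Q 1) (hS : S = Q 0 / p 0 + Q 1 / p 1)
    (hT : T = Qt + (r0 - ct0) * S)
    (sh h : Fin 2 → ℝ) (hsh : ∀ k, sh k = Q k / Qt) (hh : ∀ k, h k = p k - c k - ct k)
    (pt : ℝ → ℝ → ℝ)
    (hptdef : ∀ wi wj,
      pt wi wj = (1 - γ) * (sh i * wi + sh j * wj) / 2 + Qt / (2 * S) + (ct0 - r0) / 2)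
    (Ω : ℝ → ℝ)
    (hΩ : ∀ wi, Ω wi = c j / 2 + h j * Q j / (2 * p j * (1 - γ) * sh j * S)
      + Qt / (2 * (1 - γ) * sh j * S)
      - (ct0 - r0) / (2 * (1 - γ) * sh j) - (sh i / (2 * sh j)) * wi)
    (wbarFS : ℝ)
    (hwbarFS : wbarFS = (-(h j * Q j / p j) - c j * (1 - γ) * sh j * S
      - 4 * Qt + 4 * p 1 * S + T) / ((1 - γ) * sh i * S)) :
    (∀ w : ℝ, pt w (Ω w) ≤ p 1 ↔ w ≤ wbarFS) ∧
    StrictMono (fun w => pt w (Ω w)) ∧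
    (∃ b : ℝ, ∀ w, pt w (Ω w) = (1 - γ) * sh i / 4 * w + b) := by
  have hp : ∀ k, 0 < p k := by
    intro k
    fin_cases k
    · exact hp2.trans_le hp12
    · exact hp2
  have hQt_pos : 0 < Qt := by
    rw [hQt]
    exact add_pos (hQ 0) (hQ 1)
  have hS_pos : 0 < S := by
    rw [hS]
    exact add_pos (div_pos (hQ 0) (hp 0)) (div_pos (hQ 1) (hp 1))
  have hsh_pos : ∀ k, 0 < sh k := fun k => by
    rw [hsh]
    exact div_pos (hQ k) hQt_pos
  have hg : 0 < 1 - γ := sub_pos.mpr hγ1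
  have hslope : 0 < (1 - γ) * sh i / 4 := by
    have := hsh_pos i
    positivity
  have key : ∀ w, pt w (Ω w) = (1 - γ) * sh i / 4 * (w - wbarFS) + p 1 := by
    intro w
    have hi := (hsh_pos i).ne'
    have hj := (hsh_pos j).ne'
    have hpj := (hp j).ne'
    have hS_ne := hS_pos.ne'
    have hg_ne := hg.ne'
    rw [hptdef, hΩ, hwbarFS, hT]
    clear hS hQt hsh hh hptdef hΩ hwbarFS hT
    field_simp
    ring
  refine ⟨fun w => ?_, fun a b hab => ?_, p 1 - (1 - γ) * sh i / 4 * wbarFS, fun w => ?_⟩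
  · rw [key, add_le_iff_nonpos_left, mul_nonpos_iff_pos_imp_nonpos.trans
      ⟨fun H => H.1 hslope, fun H => ⟨fun _ => H, fun _ => hslope.le⟩⟩, sub_nonpos]
  · simp only [key]
    gcongr
  · rw [key]
    ring
end

section
/- (Proposition 2, case r_0 ≤ r̄_0, MNO 1 leader.) Assume r_0 ≤ r̄_0 and w̄_1^{FS} ≥ 0. Then the unique maximizer of the leader profit R_1^{**}(w_1) = R_1^*(w_1, Ω_2(w_1)) over the interval [0, w̄_1^{FS}] is w̄_1^{FS}; moreover w̄_1^{FS} = w_1^B, Ω_2(w̄_1^{FS}) = w_2^B, and p̃_0^{PP}(w_1^B, w_2^B) = p_2, so the optimal MVNO retail price min(p̃_0^{PP}(w_1^B, w_2^B), p_2) equals p_2. -/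
/-- Proposition 2, case `r_0 ≤ r̄_0`, MNO 1 leader.
Assume `r_0 ≤ r̄_0` and `w̄_1^{FS} ≥ 0`. Then the unique maximizer of the leader profit
`R_1^{**}(w_1) = R_1^*(w_1, Ω_2(w_1))` over `[0, w̄_1^{FS}]` is `w̄_1^{FS}`; moreover
`w̄_1^{FS} = w_1^B`, `Ω_2(w̄_1^{FS}) = w_2^B`, and `p̃_0^{PP}(w_1^B, w_2^B) = p_2`, so
the optimal MVNO retail price `min(p̃_0^{PP}(w_1^B, w_2^B), p_2)` equals `p_2`. -/
theorem stmt_10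
    (Q1 Q2 p1 p2 c1 c2 ct1 ct2 Cbar1 r0 ct0 ε γ : ℝ)
    (hQ1 : 0 < Q1) (hQ2 : 0 < Q2) (hp2 : 0 < p2) (hp12 : p2 ≤ p1)
    (hc1 : 0 ≤ c1) (hc2 : 0 ≤ c2) (hct1 : 0 ≤ ct1) (hct2 : 0 ≤ ct2) (hct0 : 0 ≤ ct0)
    (hε : 0 < ε) (hγ0 : 0 ≤ γ) (hγ1 : γ < 1)
    (Qt S T : ℝ) (hQt : Qt = Q1 + Q2) (hS : S = Q1 / p1 + Q2 / p2)
    (hT : T = Qt + (r0 - ct0) * S)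
    (sh1 sh2 h1 h2 : ℝ) (hsh1 : sh1 = Q1 / Qt) (hsh2 : sh2 = Q2 / Qt)
    (hh1 : h1 = p1 - c1 - ct1) (hh2 : h2 = p2 - c2 - ct2)
    (Qdef1 Q0 : ℝ → ℝ)
    (hQdef1 : ∀ p0, Qdef1 p0 = ε * Q1 * (p1 - p0) / p1)
    (hQ0 : ∀ p0, Q0 p0 = ε * (Qt - S * p0))
    (pt : ℝ → ℝ → ℝ)
    (hpt : ∀ w1 w2,
      pt w1 w2 = (1 - γ) * (sh1 * w1 + sh2 * w2) / 2 + Qt / (2 * S) + (ct0 - r0) / 2)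
    (Ω2 : ℝ → ℝ)
    (hΩ2 : ∀ w1, Ω2 w1 = c2 / 2 + h2 * Q2 / (2 * p2 * (1 - γ) * sh2 * S)
      + Qt / (2 * (1 - γ) * sh2 * S)
      - (ct0 - r0) / (2 * (1 - γ) * sh2) - (sh1 / (2 * sh2)) * w1)
    (F : ℝ → ℝ)
    (hF : ∀ w1, F w1 = h1 * (Q1 - Qdef1 (pt w1 (Ω2 w1))) +
      (w1 - c1) * (1 - γ) * sh1 * Q0 (pt w1 (Ω2 w1)) - Cbar1)
    (wbar1FS : ℝ)
    (hwbar1FS : wbar1FS = (-(h2 * Q2 / p2) - c2 * (1 - γ) * sh2 * S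
      - 4 * Qt + 4 * p2 * S + T) / ((1 - γ) * sh1 * S))
    (rbar0 : ℝ)
    (hrbar0 : rbar0 = h1 * Q1 / (p1 * S) + h2 * Q2 / (p2 * S)
      + (1 - γ) * (sh1 * c1 + sh2 * c2) + 7 * Qt / S + ct0 - 8 * p2)
    (w1B w2B : ℝ)
    (hw1B : w1B = (-(h2 * Q2 / p2) - c2 * (1 - γ) * sh2 * S
      - 4 * Qt + 4 * p2 * S + T) / ((1 - γ) * sh1 * S))
    (hw2B : w2B = (h2 * Q2 / p2 + c2 * (1 - γ) * sh2 * S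
      + 2 * Qt - 2 * S * p2) / ((1 - γ) * sh2 * S))
    (hr0 : r0 ≤ rbar0) (hwbar1FS0 : 0 ≤ wbar1FS) :
    IsMaxOn F (Set.Icc 0 wbar1FS) wbar1FS ∧
    (∀ w ∈ Set.Icc (0 : ℝ) wbar1FS, w ≠ wbar1FS → F w < F wbar1FS) ∧
    wbar1FS = w1B ∧ Ω2 wbar1FS = w2B ∧
    pt w1B w2B = p2 ∧ min (pt w1B w2B) p2 = p2 := by
  have hp1 : 0 < p1 := hp2.trans_le hp12
  have hQtpos : 0 < Qt := by rw [hQt]; positivity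
  have hSpos : 0 < S := by rw [hS]; positivity
  have hsh1pos : 0 < sh1 := by rw [hsh1]; positivity
  have hsh2pos : 0 < sh2 := by rw [hsh2]; positivity
  have hγ : 0 < 1 - γ := by linarith
  have hγne := hγ.ne'
  have hB : wbar1FS = w1B := by rw [hwbar1FS, hw1B]
  have hΩB : Ω2 wbar1FS = w2B := by
    rw [hΩ2, hw2B, hwbar1FS, hT]
    field_simp
    ring
  have hpt_eq (w : ℝ) : pt w (Ω2 w) = p2 - (1 - γ) * sh1 * (wbar1FS - w) / 4 := by
    rw [hpt, hΩ2, hwbar1FS, hT]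
    field_simp
    ring
  have hptB : pt w1B w2B = p2 := by
    rw [← hB, ← hΩB, hpt_eq]
    ring
  have hgap (w : ℝ) : F wbar1FS - F w = (1 - γ) * sh1 * ε * S / 4 * (wbar1FS - w) *
      (rbar0 - r0 + (1 - γ) * sh1 * (wbar1FS - w)) := by
    have hw : (1 - γ) * sh1 * wbar1FS = -(h2 * Q2 / (p2 * S)) - c2 * (1 - γ) * sh2
        - 3 * Qt / S + 4 * p2 + r0 - ct0 := by
      rw [hwbar1FS, hT]
      field_simp
      ring
    have hr : rbar0 - r0 = h1 * Q1 / (p1 * S) + 4 * Qt / S - 4 * p2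
        - (1 - γ) * sh1 * (wbar1FS - c1) := by
      rw [hrbar0]
      linear_combination hw
    rw [hr]
    simp only [hF, hpt_eq, hQdef1, hQ0]
    field_simp
    ring
  have hlt : ∀ w ∈ Set.Icc (0 : ℝ) wbar1FS, w ≠ wbar1FS → F w < F wbar1FS := by
    intro w hw hne
    have hd : 0 < wbar1FS - w := sub_pos.2 (lt_of_le_of_ne hw.2 hne)
    have hr : 0 ≤ rbar0 - r0 := sub_nonneg.2 hr0
    rw [← sub_pos, hgap]
    positivity
  refine ⟨fun w hw => ?_, hlt, hB, hΩB, hptB, by rw [hptB, min_self]⟩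
  obtain rfl | hne := eq_or_ne w wbar1FS
  · exact le_refl (F w)
  · exact (hlt w hw hne).le
end

section
/- (Proposition 2, case r_0 > r̄_0.) Fix i ∈ {1,2}, assume r_0 > r̄_0 and w̃_i^{FS} ≥ 0. Then w̃_i^{FS} < w̄_i^{FS}, the unique maximizer of the leader profit R_i^{**}(w_i) = R_i^*(w_1,w_2) evaluated at w_{−i} = Ω_{−i}(w_i) over the interval [0, w̄_i^{FS}] is w̃_i^{FS}, and the resulting MVNO critical price satisfies p̃_0^{PP} evaluated at (w̃_i^{FS}, Ω_{−i}(w̃_i^{FS})) is strictly less than p_2. -/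
/-- Proposition 2, case `r_0 > r̄_0`.
Fix `i ∈ {1,2}` (the leader) and let `−i` (here `j`) be the follower. Assume
`r_0 > r̄_0` and `w̃_i^{FS} ≥ 0`. Then `w̃_i^{FS} < w̄_i^{FS}`, the unique maximizer of
the leader profit `R_i^{**}(w_i) = R_i^*` evaluated at `w_{−i} = Ω_{−i}(w_i)` over
`[0, w̄_i^{FS}]` is `w̃_i^{FS}`, and `p̃_0^{PP}(w̃_i^{FS}, Ω_{−i}(w̃_i^{FS})) < p_2`. -/
theorem stmt_11
    (Q p c ct Cbar : Fin 2 → ℝ) (r0 ct0 ε γ : ℝ) (i j : Fin 2) (hij : j ≠ i)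
    (hQ : ∀ k, 0 < Q k) (hp2 : 0 < p 1) (hp12 : p 1 ≤ p 0)
    (hc : ∀ k, 0 ≤ c k) (hct : ∀ k, 0 ≤ ct k) (hct0 : 0 ≤ ct0)
    (hε : 0 < ε) (hγ0 : 0 ≤ γ) (hγ1 : γ < 1)
    (Qt S T : ℝ) (hQt : Qt = Q 0 + Q 1) (hS : S = Q 0 / p 0 + Q 1 / p 1)
    (hT : T = Qt + (r0 - ct0) * S)
    (sh h : Fin 2 → ℝ) (hsh : ∀ k, sh k = Q k / Qt) (hh : ∀ k, h k = p k - c k - ct k)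
    (Qdef : Fin 2 → ℝ → ℝ) (hQdef : ∀ k p0, Qdef k p0 = ε * Q k * (p k - p0) / p k)
    (Q0 : ℝ → ℝ) (hQ0 : ∀ p0, Q0 p0 = ε * (Qt - S * p0))
    (pt : ℝ → ℝ → ℝ)
    (hptdef : ∀ wi wj,
      pt wi wj = (1 - γ) * (sh i * wi + sh j * wj) / 2 + Qt / (2 * S) + (ct0 - r0) / 2)
    (Ω : ℝ → ℝ)
    (hΩ : ∀ wi, Ω wi = c j / 2 + h j * Q j / (2 * p j * (1 - γ) * sh j * S)
      + Qt / (2 * (1 - γ) * sh j * S)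
      - (ct0 - r0) / (2 * (1 - γ) * sh j) - (sh i / (2 * sh j)) * wi)
    (F : ℝ → ℝ)
    (hF : ∀ w, F w = h i * (Q i - Qdef i (pt w (Ω w))) +
      (w - c i) * (1 - γ) * sh i * Q0 (pt w (Ω w)) - Cbar i)
    (wtFS : ℝ)
    (hwtFS : wtFS = (h i * Q i / p i - h j * Q j / p j
      + S * (1 - γ) * (c i * sh i - c j * sh j) + T) / (2 * (1 - γ) * sh i * S))
    (wbarFS : ℝ)
    (hwbarFS : wbarFS = (-(h j * Q j / p j) - c j * (1 - γ) * sh j * S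
      - 4 * Qt + 4 * p 1 * S + T) / ((1 - γ) * sh i * S))
    (rbar0 : ℝ)
    (hrbar0 : rbar0 = h 0 * Q 0 / (p 0 * S) + h 1 * Q 1 / (p 1 * S)
      + (1 - γ) * (sh 0 * c 0 + sh 1 * c 1) + 7 * Qt / S + ct0 - 8 * p 1)
    (hr0 : rbar0 < r0) (hwtFS0 : 0 ≤ wtFS) :
    wtFS < wbarFS ∧
    IsMaxOn F (Set.Icc 0 wbarFS) wtFS ∧
    (∀ w ∈ Set.Icc (0 : ℝ) wbarFS, w ≠ wtFS → F w < F wtFS) ∧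
    pt wtFS (Ω wtFS) < p 1 := by
  have hp : ∀ k, 0 < p k := by
    intro k
    fin_cases k
    · exact hp2.trans_le hp12
    · exact hp2
  have hQt0 : 0 < Qt := by rw [hQt]; exact add_pos (hQ 0) (hQ 1)
  have hS0 : 0 < S := by
    rw [hS]; exact add_pos (div_pos (hQ 0) (hp 0)) (div_pos (hQ 1) (hp 1))
  have hg : 0 < 1 - γ := sub_pos.mpr hγ1
  have hsi : 0 < sh i := by rw [hsh]; exact div_pos (hQ i) hQt0
  have hsj : 0 < sh j := by rw [hsh]; exact div_pos (hQ j) hQt0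
  have hpi := hp i
  have hpj := hp j
  have haS : 0 < (1 - γ) * sh i * S := by positivity
  have threshold : h i * Q i / p i + h j * Q j / p j
      + S * (1 - γ) * (c i * sh i + c j * sh j) + 8 * Qt - 8 * p 1 * S < T := by
    have hsum : h 0 * Q 0 / p 0 + h 1 * Q 1 / p 1
        + S * (1 - γ) * (c 0 * sh 0 + c 1 * sh 1) + 8 * Qt - 8 * p 1 * S < T := by
      have hmul := mul_lt_mul_of_pos_right hr0 hS0
      have hrS : rbar0 * S = h 0 * Q 0 / p 0 + h 1 * Q 1 / p 1
          + S * (1 - γ) * (c 0 * sh 0 + c 1 * sh 1) + 7 * Qt + ct0 * S - 8 * p 1 * S := by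
        have := hp 0
        rw [hrbar0]
        field_simp
      rw [hT]
      linarith
    fin_cases i <;> fin_cases j <;> simp at hij ⊢ <;> linarith
  have price : ∀ w, pt w (Ω w) = ((1 - γ) * sh i * S * w + c j * (1 - γ) * sh j * S
      + h j * Q j / p j + 4 * Qt - T) / (4 * S) := by
    intro w
    rw [hptdef, hΩ, hT]
    field_simp
    ring
  have hwt : 2 * ((1 - γ) * sh i * S * wtFS) = h i * Q i / p i - h j * Q j / p j
      + S * (1 - γ) * (c i * sh i - c j * sh j) + T := by
    rw [hwtFS]
    field_simp
  have hwbar : (1 - γ) * sh i * S * wbarFS = -(h j * Q j / p j)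
      - c j * (1 - γ) * sh j * S - 4 * Qt + 4 * p 1 * S + T := by
    rw [hwbarFS]
    field_simp
  have hlt : wtFS < wbarFS := by
    refine lt_of_mul_lt_mul_left ?_ haS.le
    linarith
  have profit : ∀ w, F w = F wtFS - ε * ((1 - γ) * sh i) ^ 2 * S / 4 * (w - wtFS) ^ 2 := by
    intro w
    have hQd : ∀ x, h i * (Q i - Qdef i x)
        = h i * Q i - ε * (h i * Q i) + ε * (h i * Q i / p i) * x := by
      intro x
      rw [hQdef]
      field_simp
      ring
    have hai : h i * Q i / p i = 2 * ((1 - γ) * sh i * S * wtFS) + h j * Q j / p j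
        - S * (1 - γ) * (c i * sh i - c j * sh j) - T := by linarith
    rw [hF, hF, hQ0, hQ0, hQd, hQd, hai, price, price]
    generalize h j * Q j / p j = A
    field_simp
    ring
  have hcoef : 0 < ε * ((1 - γ) * sh i) ^ 2 * S / 4 := by positivity
  refine ⟨hlt, fun w _ => ?_, fun w _ hw => ?_, ?_⟩
  · change F w ≤ F wtFS
    rw [profit w]
    exact sub_le_self _ (mul_nonneg hcoef.le (sq_nonneg _))
  · rw [profit w]
    exact sub_lt_self _ (mul_pos hcoef (sq_pos_of_ne_zero (sub_ne_zero.mpr hw)))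
  · rw [price, div_lt_iff₀ (by positivity)]
    linarith [mul_lt_mul_of_pos_left hlt haS]
end

section
/- Along the boundary δ = {(w_1,w_2) : p̃_0^{PP}(w_1,w_2) = p_2}, parametrized by w_2 = Ω̄_2(w_1) = (2S p_2 − Q − S(c̃_0 − r_0) − (1−γ)π_1 S w_1)/((1−γ)π_2 S), the function w_1 ↦ R_1^*(w_1, Ω̄_2(w_1)) is affine with slope (1−γ)π_1 ε Q_1(p_1 − p_2)/p_1 ≥ 0, and the function w_1 ↦ R_2^*(w_1, Ω̄_2(w_1)) is affine with slope −(1−γ)π_1 ε Q_1(p_1 − p_2)/p_1 ≤ 0. -/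
/-- Profits along the boundary δ.
Along `δ = {(w_1,w_2) : p̃_0^{PP}(w_1,w_2) = p_2}`, parametrized by `w_2 = Ω̄_2(w_1)`,
the map `w_1 ↦ R_1^*(w_1, Ω̄_2(w_1))` is affine with slope
`(1−γ)π_1 ε Q_1(p_1 − p_2)/p_1 ≥ 0`, and `w_1 ↦ R_2^*(w_1, Ω̄_2(w_1))` is affine with
slope `−(1−γ)π_1 ε Q_1(p_1 − p_2)/p_1 ≤ 0`. -/
theorem stmt_12
    (Q1 Q2 p1 p2 c1 c2 ct1 ct2 Cbar1 Cbar2 r0 ct0 ε γ : ℝ)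
    (hQ1 : 0 < Q1) (hQ2 : 0 < Q2) (hp2 : 0 < p2) (hp12 : p2 ≤ p1)
    (hc1 : 0 ≤ c1) (hc2 : 0 ≤ c2) (hct1 : 0 ≤ ct1) (hct2 : 0 ≤ ct2) (hct0 : 0 ≤ ct0)
    (hε : 0 < ε) (hγ0 : 0 ≤ γ) (hγ1 : γ < 1)
    (Qt S : ℝ) (hQt : Qt = Q1 + Q2) (hS : S = Q1 / p1 + Q2 / p2)
    (sh1 sh2 h1 h2 : ℝ) (hsh1 : sh1 = Q1 / Qt) (hsh2 : sh2 = Q2 / Qt)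
    (hh1 : h1 = p1 - c1 - ct1) (hh2 : h2 = p2 - c2 - ct2)
    (Qdef1 Qdef2 Q0 : ℝ → ℝ)
    (hQdef1 : ∀ p0, Qdef1 p0 = ε * Q1 * (p1 - p0) / p1)
    (hQdef2 : ∀ p0, Qdef2 p0 = ε * Q2 * (p2 - p0) / p2)
    (hQ0 : ∀ p0, Q0 p0 = ε * (Qt - S * p0))
    (pt : ℝ → ℝ → ℝ)
    (hpt : ∀ w1 w2,
      pt w1 w2 = (1 - γ) * (sh1 * w1 + sh2 * w2) / 2 + Qt / (2 * S) + (ct0 - r0) / 2)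
    (Ωbar2 : ℝ → ℝ)
    (hΩbar2 : ∀ w1, Ωbar2 w1 = (2 * S * p2 - Qt - S * (ct0 - r0)
      - (1 - γ) * sh1 * S * w1) / ((1 - γ) * sh2 * S))
    (R1 R2 : ℝ → ℝ → ℝ)
    (hR1 : ∀ w1 w2, R1 w1 w2 = h1 * (Q1 - Qdef1 (pt w1 w2)) +
      (w1 - c1) * (1 - γ) * sh1 * Q0 (pt w1 w2) - Cbar1)
    (hR2 : ∀ w1 w2, R2 w1 w2 = h2 * (Q2 - Qdef2 (pt w1 w2)) +
      (w2 - c2) * (1 - γ) * sh2 * Q0 (pt w1 w2) - Cbar2) :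
    (∀ w1, pt w1 (Ωbar2 w1) = p2) ∧
    (∃ b1 : ℝ, ∀ w1,
      R1 w1 (Ωbar2 w1) = (1 - γ) * sh1 * ε * Q1 * (p1 - p2) / p1 * w1 + b1) ∧
    0 ≤ (1 - γ) * sh1 * ε * Q1 * (p1 - p2) / p1 ∧
    (∃ b2 : ℝ, ∀ w1,
      R2 w1 (Ωbar2 w1) = -((1 - γ) * sh1 * ε * Q1 * (p1 - p2) / p1) * w1 + b2) ∧
    -((1 - γ) * sh1 * ε * Q1 * (p1 - p2) / p1) ≤ 0 := by
  have hp1 : 0 < p1 := hp2.trans_le hp12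
  have hQt0 : 0 < Qt := by rw [hQt]; positivity
  have hS0 : 0 < S := by rw [hS]; positivity
  have hsh10 : 0 < sh1 := by rw [hsh1]; positivity
  have hsh20 : 0 < sh2 := by rw [hsh2]; positivity
  have hγ : 0 < 1 - γ := sub_pos.mpr hγ1
  have hboundary : ∀ w1, pt w1 (Ωbar2 w1) = p2 := by
    intro w1
    rw [hpt, hΩbar2]
    field_simp
    ring
  have hQ0p2 : Q0 p2 = ε * Q1 * (p1 - p2) / p1 := by
    rw [hQ0, hQt, hS]
    field_simp
    ring
  have hslope : 0 ≤ (1 - γ) * sh1 * ε * Q1 * (p1 - p2) / p1 := by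
    have := sub_nonneg.mpr hp12
    positivity
  have hΩ : ∀ w1, Ωbar2 w1 * (1 - γ) * sh2 =
      (2 * S * p2 - Qt - S * (ct0 - r0)) / S - (1 - γ) * sh1 * w1 := by
    intro w1
    rw [hΩbar2]
    field_simp
  refine ⟨hboundary, ⟨h1 * (Q1 - Qdef1 p2) - c1 * (1 - γ) * sh1 * Q0 p2 - Cbar1, ?_⟩, hslope,
    ⟨h2 * (Q2 - Qdef2 p2) + ((2 * S * p2 - Qt - S * (ct0 - r0)) / S
      - c2 * (1 - γ) * sh2) * Q0 p2 - Cbar2, ?_⟩, neg_nonpos.mpr hslope⟩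
  · intro w1
    rw [hR1, hboundary, hQ0p2]
    ring
  · intro w1
    rw [hR2, hboundary, sub_mul, sub_mul, hΩ, hQ0p2]
    ring
end

section
/- The pair w^C = (w_1^C, w_2^C) is the unique pair (w_1,w_2) ∈ ℝ² satisfying simultaneously w_1 = Ω_1(w_2) and w_2 = Ω_2(w_1), i.e. the unique simultaneous solution of the first-order conditions ∂R_1^*/∂w_1(w_1,w_2) = 0 and ∂R_2^*/∂w_2(w_1,w_2) = 0. -/
/-- The reaction function of an operator with share `s`, cleared of denominators. -/
theorem eq_reaction_iff {Q p c h r ct Qt S g s s' : ℝ} (hp : p ≠ 0) (hS : S ≠ 0) (hg : g ≠ 0)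
    (hs : s ≠ 0) (w w' : ℝ) :
    w = c / 2 + h * Q / (2 * p * g * s * S) + Qt / (2 * g * s * S)
        - (ct - r) / (2 * g * s) - (s' / (2 * s)) * w' ↔
      S * g * (2 * s * w + s' * w') = h * Q / p + (Qt + (r - ct) * S) + c * S * g * s := by
  have key : S * g * (2 * s * w + s' * w') - (h * Q / p + (Qt + (r - ct) * S) + c * S * g * s) =
      2 * g * s * S * (w - (c / 2 + h * Q / (2 * p * g * s * S) + Qt / (2 * g * s * S)
        - (ct - r) / (2 * g * s) - (s' / (2 * s)) * w')) := by
    field_simp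
    ring
  have hne : 2 * g * s * S ≠ 0 := by positivity
  rw [← sub_eq_zero, ← sub_eq_zero (a := S * g * _), key, mul_eq_zero, or_iff_right hne]

theorem deriv_quadratic (a b c x : ℝ) :
    deriv (fun y : ℝ => a * y ^ 2 + b * y + c) x = 2 * a * x + b := by
  have h := ((((hasDerivAt_id x).pow 2).const_mul a).add
    ((hasDerivAt_id x).const_mul b)).add_const c
  refine h.deriv.trans ?_
  simp only [id]
  ring

/-- The first-order condition of an operator with share `s`, cleared of denominators. -/
theorem deriv_profit_eq_zero_iff {Q p c h r ct Qt S g s ε : ℝ} (hp : p ≠ 0) (hS : S ≠ 0)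
    (hg : g ≠ 0) (hs : s ≠ 0) (hε : ε ≠ 0) (K z w : ℝ) {f : ℝ → ℝ}
    (hf : ∀ x, f x =
      h * (Q - ε * Q * (p - (g * (s * x + z) / 2 + Qt / (2 * S) + (ct - r) / 2)) / p) +
        (x - c) * g * s * (ε * (Qt - S * (g * (s * x + z) / 2 + Qt / (2 * S) + (ct - r) / 2)))
        - K) :
    deriv f w = 0 ↔
      S * g * (2 * s * w + z) = h * Q / p + (Qt + (r - ct) * S) + c * S * g * s := by
  have hquad : f = fun x =>
      (-(ε * S * g ^ 2 * s ^ 2 / 2)) * x ^ 2 +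
        (ε * g * s / 2 * (h * Q / p + (Qt + (r - ct) * S) + c * S * g * s - S * g * z)) * x +
        f 0 := by
    funext x
    rw [hf x, hf 0]
    field_simp
    ring
  rw [hquad, deriv_quadratic]
  have hne : -(ε * g * s / 2) ≠ 0 := by
    simp [hε, hg, hs]
  have key : 2 * (-(ε * S * g ^ 2 * s ^ 2 / 2)) * w +
        ε * g * s / 2 * (h * Q / p + (Qt + (r - ct) * S) + c * S * g * s - S * g * z) =
      -(ε * g * s / 2) * (S * g * (2 * s * w + z) -
        (h * Q / p + (Qt + (r - ct) * S) + c * S * g * s)) := by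
    ring
  rw [key, mul_eq_zero, or_iff_right hne, sub_eq_zero]

/-- The pair `w^C` as unique joint critical point.
The pair `w^C = (w_1^C, w_2^C)` is the unique pair `(w_1,w_2) ∈ ℝ²` satisfying
simultaneously `w_1 = Ω_1(w_2)` and `w_2 = Ω_2(w_1)`, i.e. the unique simultaneous
solution of the first-order conditions `∂R_1^*/∂w_1(w_1,w_2) = 0` and
`∂R_2^*/∂w_2(w_1,w_2) = 0`. -/
theorem stmt_13
    (Q1 Q2 p1 p2 c1 c2 ct1 ct2 Cbar1 Cbar2 r0 ct0 ε γ : ℝ)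
    (hQ1 : 0 < Q1) (hQ2 : 0 < Q2) (hp2 : 0 < p2) (hp12 : p2 ≤ p1)
    (hc1 : 0 ≤ c1) (hc2 : 0 ≤ c2) (hct1 : 0 ≤ ct1) (hct2 : 0 ≤ ct2) (hct0 : 0 ≤ ct0)
    (hε : 0 < ε) (hγ0 : 0 ≤ γ) (hγ1 : γ < 1)
    (Qt S T : ℝ) (hQt : Qt = Q1 + Q2) (hS : S = Q1 / p1 + Q2 / p2)
    (hT : T = Qt + (r0 - ct0) * S)
    (sh1 sh2 h1 h2 : ℝ) (hsh1 : sh1 = Q1 / Qt) (hsh2 : sh2 = Q2 / Qt)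
    (hh1 : h1 = p1 - c1 - ct1) (hh2 : h2 = p2 - c2 - ct2)
    (Qdef1 Qdef2 Q0 : ℝ → ℝ)
    (hQdef1 : ∀ p0, Qdef1 p0 = ε * Q1 * (p1 - p0) / p1)
    (hQdef2 : ∀ p0, Qdef2 p0 = ε * Q2 * (p2 - p0) / p2)
    (hQ0 : ∀ p0, Q0 p0 = ε * (Qt - S * p0))
    (pt : ℝ → ℝ → ℝ)
    (hpt : ∀ w1 w2,
      pt w1 w2 = (1 - γ) * (sh1 * w1 + sh2 * w2) / 2 + Qt / (2 * S) + (ct0 - r0) / 2)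
    (R1 R2 : ℝ → ℝ → ℝ)
    (hR1 : ∀ w1 w2, R1 w1 w2 = h1 * (Q1 - Qdef1 (pt w1 w2)) +
      (w1 - c1) * (1 - γ) * sh1 * Q0 (pt w1 w2) - Cbar1)
    (hR2 : ∀ w1 w2, R2 w1 w2 = h2 * (Q2 - Qdef2 (pt w1 w2)) +
      (w2 - c2) * (1 - γ) * sh2 * Q0 (pt w1 w2) - Cbar2)
    (Ω1 Ω2 : ℝ → ℝ)
    (hΩ1 : ∀ w2, Ω1 w2 = c1 / 2 + h1 * Q1 / (2 * p1 * (1 - γ) * sh1 * S)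
      + Qt / (2 * (1 - γ) * sh1 * S)
      - (ct0 - r0) / (2 * (1 - γ) * sh1) - (sh2 / (2 * sh1)) * w2)
    (hΩ2 : ∀ w1, Ω2 w1 = c2 / 2 + h2 * Q2 / (2 * p2 * (1 - γ) * sh2 * S)
      + Qt / (2 * (1 - γ) * sh2 * S)
      - (ct0 - r0) / (2 * (1 - γ) * sh2) - (sh1 / (2 * sh2)) * w1)
    (w1C w2C : ℝ)
    (hw1C : w1C = (2 * h1 * Q1 / p1 - h2 * Q2 / p2
      + (1 - γ) * (2 * c1 * sh1 - c2 * sh2) * S + T) / (3 * (1 - γ) * sh1 * S))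
    (hw2C : w2C = (2 * h2 * Q2 / p2 - h1 * Q1 / p1
      + (1 - γ) * (2 * c2 * sh2 - c1 * sh1) * S + T) / (3 * (1 - γ) * sh2 * S)) :
    (w1C = Ω1 w2C ∧ w2C = Ω2 w1C) ∧
    (∀ w1 w2 : ℝ, (w1 = Ω1 w2 ∧ w2 = Ω2 w1) → w1 = w1C ∧ w2 = w2C) ∧
    (∀ w1 w2 : ℝ, (w1 = Ω1 w2 ∧ w2 = Ω2 w1) ↔
      (deriv (fun x => R1 x w2) w1 = 0 ∧ deriv (fun y => R2 w1 y) w2 = 0)) := by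
  have hp1 : 0 < p1 := hp2.trans_le hp12
  have hQt0 : 0 < Qt := by rw [hQt]; positivity
  have hS0 : S ≠ 0 := by rw [hS]; positivity
  have hg : 1 - γ ≠ 0 := (sub_pos.2 hγ1).ne'
  have hs1 : sh1 ≠ 0 := by rw [hsh1]; positivity
  have hs2 : sh2 ≠ 0 := by rw [hsh2]; positivity
  have reaction1 (w1 w2 : ℝ) : w1 = Ω1 w2 ↔ S * (1 - γ) * (2 * sh1 * w1 + sh2 * w2) =
      h1 * Q1 / p1 + T + c1 * S * (1 - γ) * sh1 := by
    rw [hΩ1, hT]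
    exact eq_reaction_iff hp1.ne' hS0 hg hs1 w1 w2
  have reaction2 (w1 w2 : ℝ) : w2 = Ω2 w1 ↔ S * (1 - γ) * (2 * sh2 * w2 + sh1 * w1) =
      h2 * Q2 / p2 + T + c2 * S * (1 - γ) * sh2 := by
    rw [hΩ2, hT]
    exact eq_reaction_iff hp2.ne' hS0 hg hs2 w2 w1
  refine ⟨⟨?_, ?_⟩, ?_, fun w1 w2 => ?_⟩
  · rw [reaction1, hw1C, hw2C]
    field_simp
    ring
  · rw [reaction2, hw1C, hw2C]
    field_simp
    ring
  · rintro w1 w2 ⟨e1, e2⟩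
    rw [reaction1] at e1
    rw [reaction2] at e2
    constructor
    · rw [hw1C, eq_div_iff (by simp [hg, hs1, hS0])]
      linear_combination 2 * e1 - e2
    · rw [hw2C, eq_div_iff (by simp [hg, hs2, hS0])]
      linear_combination 2 * e2 - e1
  · rw [reaction1, reaction2, hT]
    refine and_congr (Iff.symm ?_) (Iff.symm ?_)
    · refine deriv_profit_eq_zero_iff hp1.ne' hS0 hg hs1 hε.ne' Cbar1 (sh2 * w2) w1 fun x => ?_
      rw [hR1, hQdef1, hQ0, hpt]
    · refine deriv_profit_eq_zero_iff hp2.ne' hS0 hg hs2 hε.ne' Cbar2 (sh1 * w1) w2 fun y => ?_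
      rw [hR2, hQdef2, hQ0, hpt, add_comm (sh1 * w1)]
end

section
/- One has p̃_0^{PP}(w_1^C, w_2^C) < p_2 if and only if r_0 > r_0^♭, and p̃_0^{PP}(w_1^C, w_2^C) = p_2 if and only if r_0 = r_0^♭, where r_0^♭ = h_1Q_1/(p_1 S) + h_2Q_2/(p_2 S) + (1−γ)(π_1 c_1 + π_2 c_2) + 5Q/S + c̃_0 − 6p_2. -/
/-- Threshold characterization at `w^C`.
One has `p̃_0^{PP}(w_1^C, w_2^C) < p_2` iff `r_0 > r_0^♭`, and
`p̃_0^{PP}(w_1^C, w_2^C) = p_2` iff `r_0 = r_0^♭`, where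
`r_0^♭ = h_1Q_1/(p_1S) + h_2Q_2/(p_2S) + (1−γ)(π_1c_1 + π_2c_2) + 5Q/S + c̃_0 − 6p_2`. -/
theorem stmt_14
    (Q1 Q2 p1 p2 c1 c2 ct1 ct2 r0 ct0 γ : ℝ)
    (hQ1 : 0 < Q1) (hQ2 : 0 < Q2) (hp2 : 0 < p2) (hp12 : p2 ≤ p1)
    (hc1 : 0 ≤ c1) (hc2 : 0 ≤ c2) (hct1 : 0 ≤ ct1) (hct2 : 0 ≤ ct2) (hct0 : 0 ≤ ct0)
    (hγ0 : 0 ≤ γ) (hγ1 : γ < 1)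
    (Qt S T : ℝ) (hQt : Qt = Q1 + Q2) (hS : S = Q1 / p1 + Q2 / p2)
    (hT : T = Qt + (r0 - ct0) * S)
    (sh1 sh2 h1 h2 : ℝ) (hsh1 : sh1 = Q1 / Qt) (hsh2 : sh2 = Q2 / Qt)
    (hh1 : h1 = p1 - c1 - ct1) (hh2 : h2 = p2 - c2 - ct2)
    (pt : ℝ → ℝ → ℝ)
    (hpt : ∀ w1 w2,
      pt w1 w2 = (1 - γ) * (sh1 * w1 + sh2 * w2) / 2 + Qt / (2 * S) + (ct0 - r0) / 2)
    (w1C w2C : ℝ)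
    (hw1C : w1C = (2 * h1 * Q1 / p1 - h2 * Q2 / p2
      + (1 - γ) * (2 * c1 * sh1 - c2 * sh2) * S + T) / (3 * (1 - γ) * sh1 * S))
    (hw2C : w2C = (2 * h2 * Q2 / p2 - h1 * Q1 / p1
      + (1 - γ) * (2 * c2 * sh2 - c1 * sh1) * S + T) / (3 * (1 - γ) * sh2 * S))
    (r0flat : ℝ)
    (hr0flat : r0flat = h1 * Q1 / (p1 * S) + h2 * Q2 / (p2 * S)
      + (1 - γ) * (sh1 * c1 + sh2 * c2) + 5 * Qt / S + ct0 - 6 * p2) :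
    (pt w1C w2C < p2 ↔ r0flat < r0) ∧ (pt w1C w2C = p2 ↔ r0 = r0flat) := by
  have hp1 : 0 < p1 := hp2.trans_le hp12
  have hS0 : S ≠ 0 := by rw [hS]; positivity
  have hQt0 : 0 < Qt := by rw [hQt]; positivity
  have hsh1' : sh1 ≠ 0 := by rw [hsh1]; positivity
  have hsh2' : sh2 ≠ 0 := by rw [hsh2]; positivity
  have hγ' : 1 - γ ≠ 0 := (sub_pos.2 hγ1).ne'
  have key : pt w1C w2C - p2 = (r0flat - r0) / 6 := by
    rw [hpt, hw1C, hw2C, hr0flat, hT]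
    field_simp
    ring
  constructor <;> constructor <;> intro h <;> linarith
end

section
/- (Proposition 3, case r_0 > r_0^♭.) Assume r_0 > r_0^♭ and w_1^C ≥ 0, w_2^C ≥ 0. Then, for each i ∈ {1,2}, w_i^C is the unique maximizer of the function w ↦ R_i^*(w_1,w_2), where w_i = w and w_{−i} = w_{−i}^C, over the constrained set {w ≥ 0 : p̃_0^{PP} evaluated at the pair with coordinates w and w_{−i}^C is ≤ p_2}; in particular (w_1^C, w_2^C) is a Nash equilibrium of the constrained wholesale pricing game, and the optimal MVNO retail price min(p̃_0^{PP}(w_1^C,w_2^C), p_2) = p̃_0^{PP}(w_1^C,w_2^C) < p_2. -/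
/-- With the rival's weighted price `v` fixed, the profit of an operator is a concave parabola in its
own wholesale price, so the first-order condition at `x` completes the square. -/
lemma profit_sub_eq_neg_sq {h Q p c k ε M S e v C x : ℝ} (hp : p ≠ 0) (hS : S ≠ 0)
    {P : ℝ → ℝ} (hP : ∀ w, P w = (k * w + v) / 2 + M / (2 * S) + e / 2)
    {F : ℝ → ℝ}
    (hF : ∀ w, F w = h * (Q - ε * Q * (p - P w) / p) + (w - c) * k * (ε * (M - S * P w)) - C)
    (foc : h * Q / p + (M - e * S) + k * c * S = S * (2 * (k * x) + v)) (w : ℝ) :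
    F w - F x = -(ε * S * k ^ 2 / 2 * (w - x) ^ 2) := by
  have hSP : ∀ w, S * P w = (S * (k * w + v) + M + S * e) / 2 := fun w => by
    rw [hP]; field_simp
  have hlin : P w - P x = k * (w - x) / 2 := by rw [hP, hP]; ring
  have hq : h * (Q - ε * Q * (p - P w) / p) - h * (Q - ε * Q * (p - P x) / p)
      = ε * (h * Q / p) * (P w - P x) := by field_simp; ring
  rw [hlin] at hq
  rw [hF, hF, hSP, hSP]
  linear_combination hq + ε * k * (w - x) / 2 * foc

/-- The first-order condition implies that `x` is the unique maximizer of the profit on any set. -/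
lemma isMaxOn_profit_and_lt {h Q p c k ε M S e v C x : ℝ} (hp : p ≠ 0) (hS : 0 < S)
    (hε : 0 < ε) (hk : k ≠ 0)
    {P : ℝ → ℝ} (hP : ∀ w, P w = (k * w + v) / 2 + M / (2 * S) + e / 2)
    {F : ℝ → ℝ}
    (hF : ∀ w, F w = h * (Q - ε * Q * (p - P w) / p) + (w - c) * k * (ε * (M - S * P w)) - C)
    (foc : h * Q / p + (M - e * S) + k * c * S = S * (2 * (k * x) + v)) (s : Set ℝ) :
    IsMaxOn F s x ∧ ∀ w ∈ s, w ≠ x → F w < F x := by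
  have key := profit_sub_eq_neg_sq hp hS.ne' hP hF foc
  refine ⟨fun w _ => ?_, fun w _ hne => ?_⟩
  · have : 0 ≤ ε * S * k ^ 2 / 2 * (w - x) ^ 2 := by positivity
    show F w ≤ F x
    linarith [key w]
  · have hwx := sub_ne_zero.mpr hne
    have : 0 < ε * S * k ^ 2 / 2 * (w - x) ^ 2 := by positivity
    linarith [key w]

/-- Proposition 3, case `r_0 > r_0^♭`.
Assume `r_0 > r_0^♭` and `w_1^C, w_2^C ≥ 0`. Then for each `i ∈ {1,2}`, `w_i^C` is the
unique maximizer of `w ↦ R_i^*` (with the other coordinate fixed at `w_{−i}^C`) over the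
constrained set `{w ≥ 0 : p̃_0^{PP} ≤ p_2}`; in particular `(w_1^C, w_2^C)` is a Nash
equilibrium of the constrained wholesale pricing game, and the optimal MVNO retail price
`min(p̃_0^{PP}(w_1^C,w_2^C), p_2) = p̃_0^{PP}(w_1^C,w_2^C) < p_2`. -/
theorem stmt_15
    (Q1 Q2 p1 p2 c1 c2 ct1 ct2 Cbar1 Cbar2 r0 ct0 ε γ : ℝ)
    (hQ1 : 0 < Q1) (hQ2 : 0 < Q2) (hp2 : 0 < p2) (hp12 : p2 ≤ p1)
    (hc1 : 0 ≤ c1) (hc2 : 0 ≤ c2) (hct1 : 0 ≤ ct1) (hct2 : 0 ≤ ct2) (hct0 : 0 ≤ ct0)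
    (hε : 0 < ε) (hγ0 : 0 ≤ γ) (hγ1 : γ < 1)
    (Qt S T : ℝ) (hQt : Qt = Q1 + Q2) (hS : S = Q1 / p1 + Q2 / p2)
    (hT : T = Qt + (r0 - ct0) * S)
    (sh1 sh2 h1 h2 : ℝ) (hsh1 : sh1 = Q1 / Qt) (hsh2 : sh2 = Q2 / Qt)
    (hh1 : h1 = p1 - c1 - ct1) (hh2 : h2 = p2 - c2 - ct2)
    (Qdef1 Qdef2 Q0 : ℝ → ℝ)
    (hQdef1 : ∀ p0, Qdef1 p0 = ε * Q1 * (p1 - p0) / p1)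
    (hQdef2 : ∀ p0, Qdef2 p0 = ε * Q2 * (p2 - p0) / p2)
    (hQ0 : ∀ p0, Q0 p0 = ε * (Qt - S * p0))
    (pt : ℝ → ℝ → ℝ)
    (hpt : ∀ w1 w2,
      pt w1 w2 = (1 - γ) * (sh1 * w1 + sh2 * w2) / 2 + Qt / (2 * S) + (ct0 - r0) / 2)
    (R1 R2 : ℝ → ℝ → ℝ)
    (hR1 : ∀ w1 w2, R1 w1 w2 = h1 * (Q1 - Qdef1 (pt w1 w2)) +
      (w1 - c1) * (1 - γ) * sh1 * Q0 (pt w1 w2) - Cbar1)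
    (hR2 : ∀ w1 w2, R2 w1 w2 = h2 * (Q2 - Qdef2 (pt w1 w2)) +
      (w2 - c2) * (1 - γ) * sh2 * Q0 (pt w1 w2) - Cbar2)
    (w1C w2C : ℝ)
    (hw1C : w1C = (2 * h1 * Q1 / p1 - h2 * Q2 / p2
      + (1 - γ) * (2 * c1 * sh1 - c2 * sh2) * S + T) / (3 * (1 - γ) * sh1 * S))
    (hw2C : w2C = (2 * h2 * Q2 / p2 - h1 * Q1 / p1
      + (1 - γ) * (2 * c2 * sh2 - c1 * sh1) * S + T) / (3 * (1 - γ) * sh2 * S))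
    (r0flat : ℝ)
    (hr0flat : r0flat = h1 * Q1 / (p1 * S) + h2 * Q2 / (p2 * S)
      + (1 - γ) * (sh1 * c1 + sh2 * c2) + 5 * Qt / S + ct0 - 6 * p2)
    (hr0 : r0flat < r0) (hw1C0 : 0 ≤ w1C) (hw2C0 : 0 ≤ w2C) :
    (w1C ∈ {w : ℝ | 0 ≤ w ∧ pt w w2C ≤ p2} ∧
      IsMaxOn (fun w => R1 w w2C) {w : ℝ | 0 ≤ w ∧ pt w w2C ≤ p2} w1C ∧
      (∀ w ∈ {w : ℝ | 0 ≤ w ∧ pt w w2C ≤ p2}, w ≠ w1C → R1 w w2C < R1 w1C w2C)) ∧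
    (w2C ∈ {w : ℝ | 0 ≤ w ∧ pt w1C w ≤ p2} ∧
      IsMaxOn (fun w => R2 w1C w) {w : ℝ | 0 ≤ w ∧ pt w1C w ≤ p2} w2C ∧
      (∀ w ∈ {w : ℝ | 0 ≤ w ∧ pt w1C w ≤ p2}, w ≠ w2C → R2 w1C w < R2 w1C w2C)) ∧
    pt w1C w2C < p2 ∧ min (pt w1C w2C) p2 = pt w1C w2C := by
  have hp1 : 0 < p1 := hp2.trans_le hp12
  have hSpos : 0 < S := by rw [hS]; positivity
  have hQtpos : 0 < Qt := by rw [hQt]; positivity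
  have hsh1pos : 0 < sh1 := by rw [hsh1]; positivity
  have hsh2pos : 0 < sh2 := by rw [hsh2]; positivity
  have hγ : 0 < 1 - γ := by linarith
  have e1 : w1C * (3 * (1 - γ) * sh1 * S) = 2 * h1 * Q1 / p1 - h2 * Q2 / p2
      + (1 - γ) * (2 * c1 * sh1 - c2 * sh2) * S + T := by
    rw [hw1C]; exact div_mul_cancel₀ _ (by positivity)
  have e2 : w2C * (3 * (1 - γ) * sh2 * S) = 2 * h2 * Q2 / p2 - h1 * Q1 / p1
      + (1 - γ) * (2 * c2 * sh2 - c1 * sh1) * S + T := by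
    rw [hw2C]; exact div_mul_cancel₀ _ (by positivity)
  have hlt : pt w1C w2C < p2 := by
    have hgap : 6 * (pt w1C w2C - p2) = r0flat - r0 := by
      have hsum : (1 - γ) * (sh1 * w1C + sh2 * w2C) = (h1 * Q1 / p1 + h2 * Q2 / p2
          + (1 - γ) * (sh1 * c1 + sh2 * c2) * S + 2 * T) / (3 * S) := by
        rw [eq_div_iff (by positivity)]
        linear_combination e1 + e2
      rw [hpt, hsum, hr0flat, hT]
      field_simp
      ring
    linarith
  obtain ⟨max1, lt1⟩ := isMaxOn_profit_and_lt (h := h1) (Q := Q1) (c := c1) (k := (1 - γ) * sh1)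
    (M := Qt) (e := ct0 - r0) (v := (1 - γ) * sh2 * w2C) (C := Cbar1) (x := w1C)
    (P := fun w => pt w w2C) (F := fun w => R1 w w2C) hp1.ne' hSpos hε (by positivity)
    (fun w => by simp only [hpt]; ring)
    (fun w => by simp only [hR1, hQdef1, hQ0]; ring)
    (by linear_combination -(2 / 3) * e1 - 1 / 3 * e2 - hT)
    {w : ℝ | 0 ≤ w ∧ pt w w2C ≤ p2}
  obtain ⟨max2, lt2⟩ := isMaxOn_profit_and_lt (h := h2) (Q := Q2) (c := c2) (k := (1 - γ) * sh2)
    (M := Qt) (e := ct0 - r0) (v := (1 - γ) * sh1 * w1C) (C := Cbar2) (x := w2C)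
    (P := fun w => pt w1C w) (F := fun w => R2 w1C w) hp2.ne' hSpos hε (by positivity)
    (fun w => by simp only [hpt]; ring)
    (fun w => by simp only [hR2, hQdef2, hQ0]; ring)
    (by linear_combination -(2 / 3) * e2 - 1 / 3 * e1 - hT)
    {w : ℝ | 0 ≤ w ∧ pt w1C w ≤ p2}
  exact ⟨⟨⟨hw1C0, hlt.le⟩, max1, lt1⟩, ⟨⟨hw2C0, hlt.le⟩, max2, lt2⟩, hlt, min_eq_left hlt.le⟩
end

section
/- (Proposition 3, case r_0 < r_0^♭.) Assume r_0 < r_0^♭. Then there exists no pair (w_1,w_2) ∈ ℝ² with p̃_0^{PP}(w_1,w_2) ≤ p_2 satisfying simultaneously the two first-order conditions w_1 = Ω_1(w_2) and w_2 = Ω_2(w_1) (equivalently ∂R_1^*/∂w_1(w_1,w_2) = 0 and ∂R_2^*/∂w_2(w_1,w_2) = 0). -/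
/-- A first-order condition `w = Ω(v)` with its denominators cleared, for `k = 1 - γ`. -/
lemma first_order_condition_clear_denom {k s S p : ℝ} (hk : k ≠ 0) (hs : s ≠ 0) (hS : S ≠ 0)
    (hp : p ≠ 0) {c m Q d t v w : ℝ}
    (hw : w = c / 2 + m / (2 * p * k * s * S) + Q / (2 * k * s * S) - d / (2 * k * s)
      - t / (2 * s) * v) :
    2 * (k * (s * w)) = k * (s * c) + m / (p * S) + Q / S - d - k * (t * v) := by
  rw [hw]
  field_simp


/-- Proposition 3, case `r_0 < r_0^♭`.
Assume `r_0 < r_0^♭`. Then there exists no pair `(w_1,w_2) ∈ ℝ²` with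
`p̃_0^{PP}(w_1,w_2) ≤ p_2` satisfying simultaneously the two first-order conditions
`w_1 = Ω_1(w_2)` and `w_2 = Ω_2(w_1)`. -/
theorem stmt_16
    (Q1 Q2 p1 p2 c1 c2 ct1 ct2 r0 ct0 γ : ℝ)
    (hQ1 : 0 < Q1) (hQ2 : 0 < Q2) (hp2 : 0 < p2) (hp12 : p2 ≤ p1)
    (hc1 : 0 ≤ c1) (hc2 : 0 ≤ c2) (hct1 : 0 ≤ ct1) (hct2 : 0 ≤ ct2) (hct0 : 0 ≤ ct0)
    (hγ0 : 0 ≤ γ) (hγ1 : γ < 1)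
    (Qt S : ℝ) (hQt : Qt = Q1 + Q2) (hS : S = Q1 / p1 + Q2 / p2)
    (sh1 sh2 h1 h2 : ℝ) (hsh1 : sh1 = Q1 / Qt) (hsh2 : sh2 = Q2 / Qt)
    (hh1 : h1 = p1 - c1 - ct1) (hh2 : h2 = p2 - c2 - ct2)
    (pt : ℝ → ℝ → ℝ)
    (hpt : ∀ w1 w2,
      pt w1 w2 = (1 - γ) * (sh1 * w1 + sh2 * w2) / 2 + Qt / (2 * S) + (ct0 - r0) / 2)
    (Ω1 Ω2 : ℝ → ℝ)
    (hΩ1 : ∀ w2, Ω1 w2 = c1 / 2 + h1 * Q1 / (2 * p1 * (1 - γ) * sh1 * S)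
      + Qt / (2 * (1 - γ) * sh1 * S)
      - (ct0 - r0) / (2 * (1 - γ) * sh1) - (sh2 / (2 * sh1)) * w2)
    (hΩ2 : ∀ w1, Ω2 w1 = c2 / 2 + h2 * Q2 / (2 * p2 * (1 - γ) * sh2 * S)
      + Qt / (2 * (1 - γ) * sh2 * S)
      - (ct0 - r0) / (2 * (1 - γ) * sh2) - (sh1 / (2 * sh2)) * w1)
    (r0flat : ℝ)
    (hr0flat : r0flat = h1 * Q1 / (p1 * S) + h2 * Q2 / (p2 * S)
      + (1 - γ) * (sh1 * c1 + sh2 * c2) + 5 * Qt / S + ct0 - 6 * p2)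
    (hr0 : r0 < r0flat) :
    ¬ ∃ w1 w2 : ℝ, pt w1 w2 ≤ p2 ∧ w1 = Ω1 w2 ∧ w2 = Ω2 w1 := by
  rintro ⟨w1, w2, hle, h1w, h2w⟩
  have hp1 : 0 < p1 := hp2.trans_le hp12
  have hQtpos : 0 < Qt := by rw [hQt]; positivity
  have hSpos : 0 < S := by rw [hS]; positivity
  have hs1 : sh1 ≠ 0 := by rw [hsh1]; positivity
  have hs2 : sh2 ≠ 0 := by rw [hsh2]; positivity
  have hk : 1 - γ ≠ 0 := (sub_pos.2 hγ1).ne'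
  rw [hΩ1] at h1w
  rw [hΩ2] at h2w
  have e1 := first_order_condition_clear_denom hk hs1 hSpos.ne' hp1.ne' h1w
  have e2 := first_order_condition_clear_denom hk hs2 hSpos.ne' hp2.ne' h2w
  have hhalf : Qt / (2 * S) = Qt / S / 2 := by rw [mul_comm, div_mul_eq_div_div]
  have hfive : 5 * Qt / S = 5 * (Qt / S) := mul_div_assoc _ _ _
  rw [hpt, hhalf] at hle
  rw [hr0flat, hfive] at hr0
  linarith
end

section
/- (Proposition 4(a).) Fix i ∈ {1,2}. Let w_i^* ∈ ℝ be any wholesale price of MNO i in the (Part-Part) scenario with MVNO retail price p_2 (as arises in the fully sequential model when r_0 ≤ r̄_0), and let ŵ_{−i} = min(w̄_{−i}, w̃_{−i}) and p̂_0 = min(p̃_0^{PN}(ŵ_{−i}), p_2) be the optimal wholesale and retail prices when MNO −i is the sole partner. If h_i ≥ 0 and w_i^* ≥ c_i, then the (Part-Part) profit of MNO i is at least its profit when it unilaterally deviates to non-partnership: h_i(Q_i − Q_{i,0}(p_2)) + (w_i^* − c_i)(1−γ)π_i Q_0(p_2) − C̄_i ≥ h_i(Q_i − Q_{i,0}(p̂_0))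 − C̄_i. -/
/-- Proposition 4(a).
Fix `i ∈ {1,2}` and let `−i` (here `j`) be the other MNO. Let `w_i^* ∈ ℝ` be any
wholesale price of MNO `i` in the (Part-Part) scenario with MVNO retail price `p_2`,
and let `ŵ_{−i} = min(w̄_{−i}, w̃_{−i})` and `p̂_0 = min(p̃_0^{PN}(ŵ_{−i}), p_2)` be the
optimal wholesale and retail prices when MNO `−i` is the sole partner. If `h_i ≥ 0`
and `w_i^* ≥ c_i`, then the (Part-Part) profit of MNO `i` is at least its profit when
it unilaterally deviates to non-partnership. -/
theorem stmt_18
    (Q p c ct Cbar : Fin 2 → ℝ) (r0 ct0 ε γ : ℝ) (i j : Fin 2) (hij : j ≠ i)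
    (hQ : ∀ k, 0 < Q k) (hp2 : 0 < p 1) (hp12 : p 1 ≤ p 0)
    (hc : ∀ k, 0 ≤ c k) (hct : ∀ k, 0 ≤ ct k) (hct0 : 0 ≤ ct0)
    (hε : 0 < ε) (hγ0 : 0 ≤ γ) (hγ1 : γ < 1)
    (Qt S : ℝ) (hQt : Qt = Q 0 + Q 1) (hS : S = Q 0 / p 0 + Q 1 / p 1)
    (sh h : Fin 2 → ℝ) (hsh : ∀ k, sh k = Q k / Qt) (hh : ∀ k, h k = p k - c k - ct k)
    (Qdef : Fin 2 → ℝ → ℝ) (hQdef : ∀ k p0, Qdef k p0 = ε * Q k * (p k - p0) / p k)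
    (Q0 : ℝ → ℝ) (hQ0 : ∀ p0, Q0 p0 = Qdef 0 p0 + Qdef 1 p0)
    (ptPN : ℝ → ℝ)
    (hptPN : ∀ w, ptPN w = (1 - γ) * w / 2 + Qt / (2 * S) + (ct0 - r0) / 2)
    (wtj : ℝ)
    (hwtj : wtj = c j / 2 +
      (1 / (1 - γ)) * (h j * Q j / (2 * p j * S) + Qt / (2 * S) + (r0 - ct0) / 2))
    (wbarj : ℝ) (hwbarj : wbarj = (1 / (1 - γ)) * (2 * p 1 - Qt / S + r0 - ct0))
    (what phat : ℝ) (hwhat : what = min wbarj wtj) (hphat : phat = min (ptPN what) (p 1))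
    (wistar : ℝ)
    (hhi : 0 ≤ h i) (hwistar : c i ≤ wistar) :
    h i * (Q i - Qdef i (p 1)) + (wistar - c i) * (1 - γ) * sh i * Q0 (p 1) - Cbar i ≥
      h i * (Q i - Qdef i phat) - Cbar i := by
  have hp : ∀ k, 0 < p k := Fin.forall_fin_two.2 ⟨hp2.trans_le hp12, hp2⟩
  have hp1_le : ∀ k, p 1 ≤ p k := Fin.forall_fin_two.2 ⟨hp12, le_rfl⟩
  have hphat_le : phat ≤ p 1 := hphat ▸ min_le_right _ _
  have hQdef_nonneg : ∀ k, 0 ≤ Qdef k (p 1) := fun k => by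
    rw [hQdef]
    exact div_nonneg (mul_nonneg (mul_pos hε (hQ k)).le (sub_nonneg.2 (hp1_le k))) (hp k).le
  have hQdef_le : Qdef i (p 1) ≤ Qdef i phat := by
    rw [hQdef, hQdef]
    exact div_le_div_of_nonneg_right
      (mul_le_mul_of_nonneg_left (sub_le_sub_left hphat_le _) (mul_pos hε (hQ i)).le) (hp i).le
  have hQ0_nonneg : 0 ≤ Q0 (p 1) := by
    rw [hQ0]
    exact add_nonneg (hQdef_nonneg 0) (hQdef_nonneg 1)
  have hsh_nonneg : 0 ≤ sh i := by
    rw [hsh, hQt]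
    exact div_nonneg (hQ i).le (add_pos (hQ 0) (hQ 1)).le
  have wholesale_nonneg : 0 ≤ (wistar - c i) * (1 - γ) * sh i * Q0 (p 1) :=
    mul_nonneg (mul_nonneg (mul_nonneg (sub_nonneg.2 hwistar) (sub_nonneg.2 hγ1.le))
      hsh_nonneg) hQ0_nonneg
  have retail_le : h i * (Q i - Qdef i phat) ≤ h i * (Q i - Qdef i (p 1)) :=
    mul_le_mul_of_nonneg_left (sub_le_sub_left hQdef_le _) hhi
  linarith
end

section
/- (Proposition 4(b).) Assume r_0 ≤ r̄_{2,0} and ŵ_2 ≥ c_2, where ŵ_2 = min(w̄_2, w̃_2) is the optimal wholesale price of MNO 2 as sole partner and p̂_0 = min(p̃_0^{PN}(ŵ_2), p_2) the corresponding optimal MVNO retail price. Then p̂_0 = p_2, the defection from MNO 2 vanishes (Q_{2,0}(p̂_0) = 0), and the profit of MNO 2 as sole partner is at least its profit when no MNO partners with the MVNO: h_2(Q_2 − Q_{2,0}(p̂_0)) + (ŵ_2 − c_2)(1−γ)Q_0(p̂_0) − C̄_2 ≥ h_2 Q_2 − C̄_2. -/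
/-- Proposition 4(b).
Assume `r_0 ≤ r̄_{2,0}` and `ŵ_2 ≥ c_2`, where `ŵ_2 = min(w̄_2, w̃_2)` is the optimal
wholesale price of MNO 2 as sole partner and `p̂_0 = min(p̃_0^{PN}(ŵ_2), p_2)` the
corresponding optimal MVNO retail price. Then `p̂_0 = p_2`, the defection from MNO 2
vanishes, and the profit of MNO 2 as sole partner is at least its profit when no MNO
partners with the MVNO. -/
theorem stmt_19
    (Q1 Q2 p1 p2 c1 c2 ct1 ct2 Cbar2 r0 ct0 ε γ : ℝ)
    (hQ1 : 0 < Q1) (hQ2 : 0 < Q2) (hp2 : 0 < p2) (hp12 : p2 ≤ p1)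
    (hc1 : 0 ≤ c1) (hc2 : 0 ≤ c2) (hct1 : 0 ≤ ct1) (hct2 : 0 ≤ ct2) (hct0 : 0 ≤ ct0)
    (hε : 0 < ε) (hγ0 : 0 ≤ γ) (hγ1 : γ < 1)
    (Qt S : ℝ) (hQt : Qt = Q1 + Q2) (hS : S = Q1 / p1 + Q2 / p2)
    (h2 : ℝ) (hh2 : h2 = p2 - c2 - ct2)
    (Qdef1 Qdef2 Q0 : ℝ → ℝ)
    (hQdef1 : ∀ p0, Qdef1 p0 = ε * Q1 * (p1 - p0) / p1)
    (hQdef2 : ∀ p0, Qdef2 p0 = ε * Q2 * (p2 - p0) / p2)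
    (hQ0 : ∀ p0, Q0 p0 = Qdef1 p0 + Qdef2 p0)
    (ptPN : ℝ → ℝ)
    (hptPN : ∀ w, ptPN w = (1 - γ) * w / 2 + Qt / (2 * S) + (ct0 - r0) / 2)
    (wt2 : ℝ)
    (hwt2 : wt2 = c2 / 2 +
      (1 / (1 - γ)) * (h2 * Q2 / (2 * p2 * S) + Qt / (2 * S) + (r0 - ct0) / 2))
    (wbar2 : ℝ) (hwbar2 : wbar2 = (1 / (1 - γ)) * (2 * p2 - Qt / S + r0 - ct0))
    (what2 phat : ℝ) (hwhat2 : what2 = min wbar2 wt2)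
    (hphat : phat = min (ptPN what2) p2)
    (rbar20 : ℝ)
    (hrbar20 : rbar20 = h2 * Q2 / (p2 * S) + c2 * (1 - γ) + 3 * Qt / S + ct0 - 4 * p2)
    (hr0 : r0 ≤ rbar20) (hwhat2c2 : c2 ≤ what2) :
    phat = p2 ∧ Qdef2 phat = 0 ∧
    h2 * (Q2 - Qdef2 phat) + (what2 - c2) * (1 - γ) * Q0 phat - Cbar2 ≥
      h2 * Q2 - Cbar2 := by
  have hp1 : 0 < p1 := hp2.trans_le hp12
  have hS0 : S ≠ 0 := by rw [hS]; positivity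
  have hγ : 0 < 1 - γ := sub_pos.mpr hγ1
  have hbar : (1 - γ) * wbar2 = 2 * p2 - Qt / S + r0 - ct0 := by
    rw [hwbar2]; field_simp
  have htilde : (1 - γ) * wt2 = (1 - γ) * c2 / 2 + h2 * Q2 / (p2 * S) / 2
      + Qt / S / 2 + (r0 - ct0) / 2 := by
    rw [hwt2]
    field_simp
    ring
  have hle : wbar2 ≤ wt2 := by
    refine le_of_mul_le_mul_left ?_ hγ
    have h3 : 3 * Qt / S = 3 * (Qt / S) := mul_div_assoc ..
    rw [hbar, htilde]
    linarith
  have hwhat : what2 = wbar2 := by rw [hwhat2, min_eq_left hle]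
  have hprice : ptPN what2 = p2 := by
    have h4 : Qt / (2 * S) = Qt / S / 2 := by field_simp
    rw [hptPN, hwhat, hbar, h4]
    ring
  have hphat2 : phat = p2 := by rw [hphat, hprice, min_self]
  have hdef2 : Qdef2 phat = 0 := by simp [hQdef2, hphat2]
  have hdef1 : 0 ≤ Qdef1 phat := by
    rw [hQdef1, hphat2]
    have := sub_nonneg.mpr hp12
    positivity
  refine ⟨hphat2, hdef2, ?_⟩
  have hrevenue : 0 ≤ (what2 - c2) * (1 - γ) * Qdef1 phat :=
    mul_nonneg (mul_nonneg (sub_nonneg.mpr hwhat2c2) hγ.le) hdef1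
  rw [hQ0, hdef2, add_zero, sub_zero]
  linarith
end
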